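/- arXiv:2012.15264 — 4 statements merged into one kernel-verified Lean document; each statement's English description precedes it below -/
import Mathlib

section
/- Let X be a topological space, x₀ ∈ X, and U ⊆ X open. If α, β ∈ P(X,x₀) lie in the same path-component of ev⁻¹(U) ⊆ P(X,x₀), then there exists a path λ : [0,1] → U with λ(0) = α(1) and λ(1) = β(1) such that the concatenation α·λ is path-homotopic to β in X. -/
open Set unitInterval

/-- `P(X,x₀)`: the space of continuous paths `α : I → X` with `α 0 = x₀`,
with the compact-open topology (the subspace topology from `C(I,X)`). -/
abbrev PathSpace (X : Type*) [TopologicalSpace X] (x₀ : X) : Type _ :=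
  {α : C(I, X) // α 0 = x₀}

variable {X : Type*} [TopologicalSpace X]

/-- The evaluation map `ev : P(X,x₀) → X`, `ev α = α 1`. -/
def ev (x₀ : X) (α : PathSpace X x₀) : X := α.1 1

/-- Two based paths are path-homotopic if they are homotopic rel endpoints. -/
def PathHomotopicSetoid (X : Type*) [TopologicalSpace X] (x₀ : X) :
    Setoid (PathSpace X x₀) where
  r α β := Nonempty (α.1.HomotopyRel β.1 {0, 1})
  iseqv := ⟨fun α => ⟨.refl α.1 _⟩, fun ⟨h⟩ => ⟨h.symm⟩, fun ⟨h⟩ ⟨h'⟩ => ⟨h.trans h'⟩⟩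

/-- The based fundamental groupoid `Π(X,x₀) = P(X,x₀)/∼`, with the quotient topology. -/
abbrev FundGroupoid (X : Type*) [TopologicalSpace X] (x₀ : X) : Type _ :=
  Quotient (PathHomotopicSetoid X x₀)

/-- The quotient map `q : P(X,x₀) → Π(X,x₀)`. -/
def qmap (x₀ : X) (α : PathSpace X x₀) : FundGroupoid X x₀ :=
  Quotient.mk (PathHomotopicSetoid X x₀) α

/-- The induced map `p : Π(X,x₀) → X`, `p [α] = α 1`. -/
def pmap (x₀ : X) : FundGroupoid X x₀ → X :=
  Quotient.lift (fun α => α.1 1)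
    (fun _ _ ⟨h⟩ => h.fst_eq_snd (by simp))

/-- A subset `U ⊆ X` is an slsc-subset if every loop in `U` is nullhomotopic in `X`. -/
def IsSlscSubset (U : Set X) : Prop :=
  ∀ x ∈ U, ∀ γ : Path x x, (∀ t, γ t ∈ U) → γ.Homotopic (Path.refl x)

/-- `X` is semi-locally simply connected if it can be covered by open slsc-subsets. -/
def SemilocallySimplyConnected (X : Type*) [TopologicalSpace X] : Prop :=
  ∀ x : X, ∃ U : Set X, x ∈ U ∧ IsOpen U ∧ IsSlscSubset U

/-- A based path, viewed as a `Path` from `x₀` to its endpoint. -/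
def toPath {x₀ : X} (α : PathSpace X x₀) : Path x₀ (α.1 1) :=
  ⟨α.1, α.2, rfl⟩

/-- The standard lift `α̃ : I → Π(X,x₀)`, `α̃ t = [s ↦ α (s*t)]`. -/
def liftPath (x₀ : X) (α : PathSpace X x₀) (t : I) : FundGroupoid X x₀ :=
  qmap x₀ ⟨⟨fun s => α.1 ⟨s.1 * t.1, unitInterval.mul_mem s.2 t.2⟩, by fun_prop⟩,
    by
    show α.1 _ = x₀
    rw [show (⟨(0:I).1 * t.1, unitInterval.mul_mem (0:I).2 t.2⟩ : I) = 0 from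
      Subtype.ext (zero_mul t.1), α.2]⟩

/-- The two ways around the boundary of a square `I × I → X` are homotopic paths. -/
theorem Path.Homotopic.trans_of_square (G : C(I × I, X)) {x y z w : X}
    {a : Path x y} {b : Path y z} {c : Path x w} {d : Path w z}
    (ha : ∀ s, a s = G (0, s)) (hb : ∀ t, b t = G (t, 1))
    (hc : ∀ t, c t = G (t, 0)) (hd : ∀ s, d s = G (1, s)) :
    (a.trans b).Homotopic (c.trans d) := by
  obtain rfl : G (0, 0) = x := by rw [← ha, a.source]
  obtain rfl : G (0, 1) = y := by rw [← ha, a.target]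
  obtain rfl : G (1, 1) = z := by rw [← hb, b.target]
  obtain rfl : G (1, 0) = w := by rw [← hc, c.target]
  let e : Path (0 : I) 1 := ⟨ContinuousMap.id I, rfl, rfl⟩
  let left : Path ((0, 0) : I × I) (0, 1) := (Path.refl 0).prod e
  let top : Path ((0, 1) : I × I) (1, 1) := e.prod (Path.refl 1)
  let bot : Path ((0, 0) : I × I) (1, 0) := e.prod (Path.refl 0)
  let right : Path ((1, 0) : I × I) (1, 1) := (Path.refl 1).prod e
  obtain rfl : left.map G.continuous = a := Path.ext (funext fun s => (ha s).symm)
  obtain rfl : top.map G.continuous = b := Path.ext (funext fun t => (hb t).symm)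
  obtain rfl : bot.map G.continuous = c := Path.ext (funext fun t => (hc t).symm)
  obtain rfl : right.map G.continuous = d := Path.ext (funext fun s => (hd s).symm)
  rw [← Path.map_trans, ← Path.map_trans]
  have : ContractibleSpace I := (convex_Icc (0 : ℝ) 1).contractibleSpace ⟨0, by simp⟩
  exact (SimplyConnectedSpace.paths_homotopic (left.trans top) (bot.trans right)).map G

/-- If `α, β ∈ P(X,x₀)` lie in the same path-component of `ev⁻¹(U)` for an
open `U ⊆ X`, then there is a path `λ` in `U` from `α 1` to `β 1` such that the
concatenation `α·λ` is path-homotopic to `β`. -/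
theorem joinedIn_ev_preimage (x₀ : X) (U : Set X) (hU : IsOpen U)
    (α β : PathSpace X x₀) (h : JoinedIn (ev x₀ ⁻¹' U) α β) :
    ∃ lam : Path (α.1 1) (β.1 1), (∀ t, lam t ∈ U) ∧
      ((toPath α).trans lam).Homotopic (toPath β) := by
  obtain ⟨γ, hγ⟩ := h
  let F : C(I × I, X) := ⟨fun p => (γ p.1).1 p.2, by fun_prop⟩
  let lam : Path (α.1 1) (β.1 1) :=
    ⟨⟨fun t => F (t, 1), by fun_prop⟩, by simp [F], by simp [F]⟩
  refine ⟨lam, hγ, ?_⟩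
  have hsq : ((toPath α).trans lam).Homotopic ((Path.refl x₀).trans (toPath β)) :=
    Path.Homotopic.trans_of_square F (fun s => by simp [F, toPath]) (fun _ => rfl)
      (fun t => (γ t).2.symm) (fun s => by simp [F, toPath])
  exact hsq.trans ⟨Path.Homotopy.reflTrans _⟩
end

section
/- Let X be a topological space, x₀ ∈ X, and let U ⊆ X be an slsc-subset. If α, α' ∈ P(X,x₀) lie in the same path-component of ev⁻¹(U) ⊆ P(X,x₀) and α(1) = α'(1), then α and α' are path-homotopic in X. -/
open Set unitInterval

variable {X : Type*} [TopologicalSpace X]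

/-- The two ways around the boundary of a singular square are homotopic. -/
theorem Path.Homotopic.trans_of_square_s5 {w x y z : X} (H : C(I × I, X))
    (left : Path w x) (top : Path x z) (bottom : Path w y) (right : Path y z)
    (hl : ∀ s, H (0, s) = left s) (ht : ∀ t, H (t, 1) = top t)
    (hb : ∀ t, H (t, 0) = bottom t) (hr : ∀ s, H (1, s) = right s) :
    (left.trans top).Homotopic (bottom.trans right) := by
  obtain rfl : H (0, 0) = w := by rw [hl, left.source]
  obtain rfl : H (0, 1) = x := by rw [hl, left.target]
  obtain rfl : H (1, 0) = y := by rw [hr, right.source]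
  obtain rfl : H (1, 1) = z := by rw [hr, right.target]
  let e : Path (0 : I) 1 := ⟨ContinuousMap.id I, rfl, rfl⟩
  have hl' : left = ((Path.refl 0).prod e).map H.continuous := by ext s; exact (hl s).symm
  have ht' : top = (e.prod (Path.refl 1)).map H.continuous := by ext t; exact (ht t).symm
  have hb' : bottom = (e.prod (Path.refl 0)).map H.continuous := by ext t; exact (hb t).symm
  have hr' : right = ((Path.refl 1).prod e).map H.continuous := by ext s; exact (hr s).symm
  have he : ((Path.refl 0).trans e).Homotopy (e.trans (Path.refl 1)) :=
    (Path.Homotopy.reflTrans e).trans (Path.Homotopy.transRefl e).symm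
  rw [hl', ht', hb', hr', ← Path.map_trans, ← Path.map_trans,
    Path.trans_prod_eq_prod_trans, Path.trans_prod_eq_prod_trans]
  exact Path.Homotopic.map ⟨Path.Homotopic.prodHomotopy he he.symm⟩ H

/-- If `U ⊆ X` is an slsc-subset and `α, α' ∈ P(X,x₀)` lie in the same
path-component of `ev⁻¹(U)` with `α 1 = α' 1`, then `α` and `α'` are path-homotopic
(homotopic rel endpoints) in `X`. -/
theorem pathHomotopic_of_joinedIn_slsc (x₀ : X) (U : Set X) (hU : IsSlscSubset U)
    (α α' : PathSpace X x₀) (h : JoinedIn (ev x₀ ⁻¹' U) α α') (he : α.1 1 = α'.1 1) :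
    Nonempty (α.1.HomotopyRel α'.1 {0, 1}) := by
  obtain ⟨γ, hγ⟩ := h
  have hcont : Continuous fun t => (γ t).1 := continuous_subtype_val.comp γ.continuous
  let H : C(I × I, X) := ContinuousMap.uncurry ⟨fun t => (γ t).1, hcont⟩
  have hH (t s : I) : H (t, s) = (γ t).1 s := rfl
  let δ : Path (α.1 1) (α.1 1) :=
    { toFun := fun t => H (t, 1)
      continuous_toFun := by fun_prop
      source' := by rw [hH, γ.source]
      target' := by rw [hH, γ.target, he] }
  have hδ : δ.Homotopic (Path.refl _) := by
    refine hU _ ?_ δ hγ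
    simpa [ev] using hγ 0
  let β : Path x₀ (α.1 1) := (toPath α').cast rfl he
  have hsq : ((toPath α).trans δ).Homotopic ((Path.refl x₀).trans β) := by
    refine Path.Homotopic.trans_of_square_s5 H _ _ _ _ (fun s => ?_) (fun t => rfl)
      (fun t => (γ t).2) (fun s => ?_)
    · rw [hH, γ.source]; rfl
    · rw [hH, γ.target]; rfl
  have h₁ : (toPath α).Homotopic ((toPath α).trans δ) :=
    Path.Homotopic.trans ⟨(Path.Homotopy.transRefl _).symm⟩
      (Path.Homotopic.hcomp (.refl _) hδ.symm)
  exact (h₁.trans hsq).trans ⟨Path.Homotopy.reflTrans _⟩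
end

section
/- Let X be a topological space, x₀ ∈ X, and α ∈ P(X,x₀). Then the map α̃ : [0,1] → Π(X,x₀) defined by α̃(t) := [s ↦ α(st)] is a continuous path in Π(X,x₀) with p ∘ α̃ = α, α̃(0) = [c_{x₀}] (the class of the constant path at x₀), and α̃(1) = [α]. -/
open Set unitInterval

variable {X : Type*} [TopologicalSpace X]

theorem continuous_liftPath (x₀ : X) (α : PathSpace X x₀) : Continuous (liftPath x₀ α) := by
  let H : C(I × I, X) := ⟨fun z => α.1 (z.2 * z.1), by fun_prop⟩
  exact continuous_quotient_mk'.comp (H.curry.continuous.subtype_mk _)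

/-- For any `α ∈ P(X,x₀)`, the map `α̃ : I → Π(X,x₀)`,
`α̃ t = [s ↦ α (s*t)]`, is a continuous path in `Π(X,x₀)` with `p ∘ α̃ = α`,
`α̃ 0 = [c_{x₀}]` and `α̃ 1 = [α]`. -/
theorem liftPath_spec (x₀ : X) (α : PathSpace X x₀) :
    Continuous (liftPath x₀ α) ∧ (∀ t, pmap x₀ (liftPath x₀ α t) = α.1 t) ∧
      liftPath x₀ α 0 = qmap x₀ ⟨ContinuousMap.const I x₀, rfl⟩ ∧
      liftPath x₀ α 1 = qmap x₀ α := by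
  refine ⟨continuous_liftPath x₀ α, fun t => ?_, ?_, ?_⟩
  · exact congrArg α.1 (one_mul t)
  · refine congrArg (qmap x₀) (Subtype.ext (ContinuousMap.ext fun s => ?_))
    exact (congrArg α.1 (mul_zero s)).trans α.2
  · refine congrArg (qmap x₀) (Subtype.ext (ContinuousMap.ext fun s => ?_))
    exact congrArg α.1 (mul_one s)
end

section
/- Let X be a topological space, x₀ ∈ X, and U ⊆ X open. Let α ∈ P(X,x₀) with α(1) ∈ U, let 0 = t₀ < t₁ < ⋯ < tₙ = 1, let U₁,…,Uₙ ⊆ X be open slsc-subsets with α([t_{i−1},t_i]) ⊆ U_i for all i, and let V₁,…,Vₙ ⊆ X be path-connected open sets with α(t_i) ∈ V_i ⊆ U_i ∩ U_{i+1} for i = 1,…,n−1 and α(1) ∈ Vₙ ⊆ Uₙ ∩ U. Then every β ∈ P(X,x₀) satisfying β([t_{i−1},t_i]) ⊆ U_i and β(t_i) ∈ V_i for all i lies in the same path-component of ev⁻¹(U) as α; in particular there exists a path λ in U from α(1) to β(1) with α·λ path-homotopic to β. -/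
open Set unitInterval

variable {X : Type*} [TopologicalSpace X]

/-- A path starting at `x₀`, viewed as a point of the based path space. -/
def Path.toPathSpace {x₀ b : X} (p : Path x₀ b) : PathSpace X x₀ :=
  ⟨p.toContinuousMap, p.source⟩

theorem joinedIn_ev_preimage_of_family {x₀ : X} {U : Set X} {e : I → X}
    (p : ∀ s, Path x₀ (e s)) (hp : Continuous fun x : I × I => p x.1 x.2) (he : ∀ s, e s ∈ U) :
    JoinedIn (ev x₀ ⁻¹' U) (p 0).toPathSpace (p 1).toPathSpace :=
  ⟨{ toFun := fun s => (p s).toPathSpace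
     continuous_toFun := Continuous.subtype_mk
       (ContinuousMap.continuous_of_continuous_uncurry _ hp) _
     source' := rfl
     target' := rfl },
   fun s => by
    change p s 1 ∈ U
    rw [(p s).target]
    exact he s⟩

theorem Path.Homotopic.joinedIn_ev_preimage {x₀ b : X} {U : Set X} {p q : Path x₀ b}
    (h : p.Homotopic q) (hb : b ∈ U) :
    JoinedIn (ev x₀ ⁻¹' U) p.toPathSpace q.toPathSpace := by
  obtain ⟨F⟩ := h
  simpa only [F.eval_zero, F.eval_one] using
    joinedIn_ev_preimage_of_family (U := U) F.eval F.continuous fun _ => hb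

/-- Concatenating with a path in `U` does not change the path component in `ev⁻¹(U)`. -/
theorem joinedIn_ev_preimage_trans {x₀ b c : X} {U : Set X} (p : Path x₀ b) (l : Path b c)
    (hl : ∀ s, l s ∈ U) : JoinedIn (ev x₀ ⁻¹' U) p.toPathSpace (p.trans l).toPathSpace := by
  have hb : b ∈ U := l.source ▸ hl 0
  have hrefl : JoinedIn (ev x₀ ⁻¹' U) p.toPathSpace (p.trans (Path.refl b)).toPathSpace :=
    Path.Homotopic.joinedIn_ev_preimage (Path.Homotopic.symm ⟨Path.Homotopy.transRefl p⟩) hb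
  refine hrefl.trans ?_
  have h := joinedIn_ev_preimage_of_family (U := U)
    (fun s => (p.cast rfl l.source).trans (l.subpath 0 s)) ?_ hl
  · convert h using 1
    · refine Subtype.ext (ContinuousMap.ext fun t => ?_)
      simp [Path.toPathSpace, Path.trans_apply]
    · refine Subtype.ext (ContinuousMap.ext fun t => ?_)
      simp [Path.toPathSpace, Path.trans_apply]
  · refine Path.trans_continuous_family (fun _ => p.cast rfl l.source) ?_
      (fun s => l.subpath 0 s) ?_
    · exact p.continuous.comp continuous_snd
    · exact l.subpath_continuous_family.comp (continuous_const.prodMk continuous_id)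

/-- Two paths with common endpoints inside an slsc-subset are homotopic. -/
theorem IsSlscSubset.homotopic {W : Set X} (hW : IsSlscSubset W) {a b : X} {p q : Path a b}
    (hp : range p ⊆ W) (hq : range q ⊆ W) : p.Homotopic q := by
  have ha : a ∈ W := hp ⟨0, p.source⟩
  have h := hW a ha (p.trans q.symm) fun t => by
    have : range (p.trans q.symm) ⊆ W := by
      rw [Path.trans_range, Path.symm_range]
      exact union_subset hp hq
    exact this (mem_range_self t)
  rw [← Path.Homotopic.Quotient.eq] at h ⊢
  rw [Path.Homotopic.Quotient.mk_trans, Path.Homotopic.Quotient.mk_symm,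
    Path.Homotopic.Quotient.mk_refl] at h
  rw [← Path.Homotopic.Quotient.trans_refl (.mk p),
    ← Path.Homotopic.Quotient.symm_trans (.mk q), ← Path.Homotopic.Quotient.trans_assoc, h,
    Path.Homotopic.Quotient.refl_trans]

/-- Extending a homotopy between initial segments of two paths across a square contained in an
slsc-subset. -/
theorem IsSlscSubset.homotopic_subpath_trans {W : Set X} (hW : IsSlscSubset W) {x₀ a b : X}
    (p : Path x₀ a) (q : Path x₀ b) {s t : I} (hst : s ≤ t)
    (hp : MapsTo p (Icc s t) W) (hq : MapsTo q (Icc s t) W)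
    (l : Path (p s) (q s)) (m : Path (p t) (q t)) (hl : range l ⊆ W) (hm : range m ⊆ W)
    (h : ((p.subpath 0 s).trans l).Homotopic
      ((q.subpath 0 s).cast (p.source.trans q.source.symm) rfl)) :
    ((p.subpath 0 t).trans m).Homotopic
      ((q.subpath 0 t).cast (p.source.trans q.source.symm) rfl) := by
  have e : p 0 = q 0 := p.source.trans q.source.symm
  have hsq : ((p.subpath s t).trans m).Homotopic (l.trans (q.subpath s t)) := by
    apply hW.homotopic
    · rw [Path.trans_range, Path.range_subpath_of_le _ _ _ hst]
      exact union_subset hp.image_subset hm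
    · rw [Path.trans_range, Path.range_subpath_of_le _ _ _ hst]
      exact union_subset hl hq.image_subset
  have hp' : ((p.subpath 0 s).trans (p.subpath s t)).Homotopic (p.subpath 0 t) :=
    ⟨Path.Homotopy.subpathTransSubpath p 0 s t⟩
  have hq' : (((q.subpath 0 s).cast e rfl).trans (q.subpath s t)).Homotopic
      ((q.subpath 0 t).cast e rfl) :=
    Path.Homotopic.pathCast ⟨Path.Homotopy.subpathTransSubpath q 0 s t⟩ e rfl
  rw [← Path.Homotopic.Quotient.eq] at *
  simp only [Path.Homotopic.Quotient.mk_trans] at *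
  rw [← hp', Path.Homotopic.Quotient.trans_assoc, hsq, ← Path.Homotopic.Quotient.trans_assoc, h,
    hq']

/-- Given `α ∈ ev⁻¹(U)`, a partition `0 = t₀ < t₁ < ⋯ < tₙ = 1`, open
slsc-sets `Uᵢ` with `α([t_{i-1},t_i]) ⊆ Uᵢ`, and path-connected open sets `Vᵢ` with
`α(tᵢ) ∈ Vᵢ ⊆ Uᵢ ∩ U_{i+1}` (and `α(1) ∈ Vₙ ⊆ Uₙ ∩ U`), every `β ∈ P(X,x₀)` with
`β([t_{i-1},t_i]) ⊆ Uᵢ` and `β(tᵢ) ∈ Vᵢ` lies in the same path-component of `ev⁻¹(U)`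
as `α`; in particular there is a path `λ` in `U` from `α 1` to `β 1` with `α·λ`
path-homotopic to `β`. -/
theorem joinedIn_of_chain (x₀ : X) (U : Set X) (hU : IsOpen U)
    (α : PathSpace X x₀) (hα1 : α.1 1 ∈ U)
    (n : ℕ) (hn : 0 < n) (t : Fin (n + 1) → I)
    (htmono : StrictMono t) (ht0 : t 0 = 0) (ht1 : t (Fin.last n) = 1)
    (U' : Fin n → Set X) (hU'o : ∀ i, IsOpen (U' i)) (hU's : ∀ i, IsSlscSubset (U' i))
    (hαU' : ∀ i : Fin n, Set.MapsTo α.1 (Set.Icc (t i.castSucc) (t i.succ)) (U' i))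
    (V : Fin n → Set X) (hVo : ∀ i, IsOpen (V i)) (hVpc : ∀ i, IsPathConnected (V i))
    (hαV : ∀ i : Fin n, α.1 (t i.succ) ∈ V i)
    (hVU' : ∀ i : Fin n, V i ⊆ U' i)
    (hVnext : ∀ i : Fin n, ∀ h : i.1 + 1 < n, V i ⊆ U' ⟨i.1 + 1, h⟩)
    (hVlast : V ⟨n - 1, by omega⟩ ⊆ U)
    (β : PathSpace X x₀)
    (hβU' : ∀ i : Fin n, Set.MapsTo β.1 (Set.Icc (t i.castSucc) (t i.succ)) (U' i))
    (hβV : ∀ i : Fin n, β.1 (t i.succ) ∈ V i) :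
    JoinedIn (ev x₀ ⁻¹' U) α β ∧
      ∃ lam : Path (α.1 1) (β.1 1), (∀ s, lam s ∈ U) ∧
        ((toPath α).trans lam).Homotopic (toPath β) := by
  have step : ∀ i : Fin (n + 1), ∃ m : Path (toPath α (t i)) (toPath β (t i)),
      (∀ j : Fin n, j.castSucc = i → range m ⊆ U' j) ∧
      (∀ j : Fin n, j.succ = i → range m ⊆ V j) ∧
      (((toPath α).subpath 0 (t i)).trans m).Homotopic
        (((toPath β).subpath 0 (t i)).cast
          ((toPath α).source.trans (toPath β).source.symm) rfl) := by
    intro i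
    induction i using Fin.induction with
    | zero =>
      have e : toPath α 0 = toPath β 0 := (toPath α).source.trans (toPath β).source.symm
      have hmem : ∀ j : Fin n, j.castSucc = 0 → toPath α 0 ∈ U' j := fun j hj =>
        hαU' j ⟨by rw [hj, ht0], by rw [← ht0]; exact htmono.monotone (Fin.zero_le _)⟩
      rw [ht0]
      refine ⟨(Path.refl _).cast rfl e.symm, fun j hj => ?_,
        fun j hj => absurd hj (Fin.succ_ne_zero j), ?_⟩
      · rintro _ ⟨s, rfl⟩
        exact hmem j hj
      · have h : ∀ {x y : X} (e : x = y),
            ((Path.refl x).trans ((Path.refl x).cast rfl e.symm)).Homotopic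
              ((Path.refl y).cast e rfl) := by
          rintro x _ rfl
          exact ⟨Path.Homotopy.transRefl _⟩
        simpa only [Path.subpath_self] using h e
    | succ i ih =>
      obtain ⟨l, hl, -, hlh⟩ := ih
      obtain ⟨m, hm⟩ := (hVpc i).joinedIn _ (hαV i) _ (hβV i)
      have hmV : range m ⊆ V i := range_subset_iff.2 hm
      refine ⟨m, fun j hj => ?_, fun j hj => ?_, ?_⟩
      · have hji : j.1 = i.1 + 1 := by simpa using congrArg Fin.val hj
        rw [show j = ⟨i.1 + 1, hji ▸ j.2⟩ from Fin.ext hji]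
        exact hmV.trans (hVnext i _)
      · rwa [Fin.succ_injective _ hj]
      · exact (hU's i).homotopic_subpath_trans _ _ (htmono.monotone i.castSucc_lt_succ.le)
          (hαU' i) (hβU' i) l m (hl i rfl) (hmV.trans (hVU' i)) hlh
  have hlast := step (Fin.last n)
  rw [ht1] at hlast
  obtain ⟨m, -, hmV, hm⟩ := hlast
  have hmU : ∀ s, m s ∈ U := fun s =>
    hVlast (hmV ⟨n - 1, by omega⟩ (Fin.ext (by simp; omega)) (mem_range_self s))
  let lam : Path (α.1 1) (β.1 1) := m
  have hlam : ((toPath α).trans lam).Homotopic (toPath β) := by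
    have h := hm.pathCast (toPath α).source.symm rfl
    simp only [Path.subpath_zero_one] at h
    exact h
  exact ⟨(joinedIn_ev_preimage_trans (toPath α) lam hmU).trans
    (hlam.joinedIn_ev_preimage (lam.target ▸ hmU 1)), lam, hmU, hlam⟩
end
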